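/- arXiv:2203.01410 — 2 statements merged into one kernel-verified Lean document; each statement's English description precedes it below -/
import Mathlib

section
/- Let A be the 6×6 real matrix with rows (0,1,0,0,0,0), (1.000002542612694, 0, 0, 2, 0, 0), (0,0,0,1,0,0), (0, -0.000294117647059, 0, 0, 0, 0), (0,0,0,0,0,1), (0,0,0,0,-0.00000127311747,0), and let B be the 6×2 matrix whose columns are (0,1,0,0,0,0)ᵀ and (0,0,0,1,0,0)ᵀ (thrusters in the r- and θ-directions). Then the Kalman controllability matrix Q = [B, AB, A²B, A³B, A⁴B, A⁵B], viewed as a 6×12 real matrix, has rank 4; in particular its rank is strictly less than 6. -/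
/-- Linearized satellite dynamics matrix under the `J₂` zonal harmonic. -/
def A : Matrix (Fin 6) (Fin 6) ℝ :=
  !![0, 1, 0, 0, 0, 0;
     1.000002542612694, 0, 0, 2, 0, 0;
     0, 0, 0, 1, 0, 0;
     0, -0.000294117647059, 0, 0, 0, 0;
     0, 0, 0, 0, 0, 1;
     0, 0, 0, 0, -0.00000127311747, 0]

/-- Input matrix: thruster columns. -/
def B : Matrix (Fin 6) (Fin 2) ℝ :=
  !![0, 0;
     1, 0;
     0, 0;
     0, 1;
     0, 0;
     0, 0]

/-- Kalman controllability matrix `Q = [B, AB, A²B, A³B, A⁴B, A⁵B]`,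
viewed as a `6 × 12` real matrix with columns indexed by `Fin 6 × Fin 2`. -/
def Q : Matrix (Fin 6) (Fin 6 × Fin 2) ℝ :=
  Matrix.of fun i p => (A ^ (p.1 : ℕ) * B) i p.2

/-- The inclusion of the in-plane states `(X₁, X₂, X₃, X₄)` into the full state space. -/
def planarInclusion : Matrix (Fin 6) (Fin 4) ℝ :=
  !![1, 0, 0, 0;
     0, 1, 0, 0;
     0, 0, 1, 0;
     0, 0, 0, 1;
     0, 0, 0, 0;
     0, 0, 0, 0]

/-- The restriction of the dynamics `A` to the in-plane states. -/
def planarA : Matrix (Fin 4) (Fin 4) ℝ :=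
  !![0, 1, 0, 0;
     1.000002542612694, 0, 0, 2;
     0, 0, 0, 1;
     0, -0.000294117647059, 0, 0]

/-- The input matrix with values in the in-plane states. -/
def planarB : Matrix (Fin 4) (Fin 2) ℝ :=
  !![0, 0;
     1, 0;
     0, 0;
     0, 1]

theorem A_mul_planarInclusion : A * planarInclusion = planarInclusion * planarA := by
  ext i j
  fin_cases i <;> fin_cases j <;>
    simp [A, planarInclusion, planarA, Matrix.mul_apply, Fin.sum_univ_succ]

theorem planarInclusion_mul_planarB : planarInclusion * planarB = B := by
  ext i j
  fin_cases i <;> fin_cases j <;>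
    simp [B, planarInclusion, planarB, Matrix.mul_apply, Fin.sum_univ_succ]

theorem A_pow_mul_B (k : ℕ) : A ^ k * B = planarInclusion * (planarA ^ k * planarB) := by
  induction k with
  | zero => simp [planarInclusion_mul_planarB]
  | succ k ih =>
    rw [pow_succ', pow_succ', Matrix.mul_assoc, ih, ← Matrix.mul_assoc, A_mul_planarInclusion,
      Matrix.mul_assoc, Matrix.mul_assoc]

theorem Q_eq_planarInclusion_mul :
    Q = planarInclusion * Matrix.of fun i p => (planarA ^ (p.1 : ℕ) * planarB) i p.2 := by
  ext i p
  simp only [Q, Matrix.of_apply, A_pow_mul_B]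
  rfl

theorem rank_Q_le : Q.rank ≤ 4 := by
  rw [Q_eq_planarInclusion_mul]
  exact (Matrix.rank_mul_le_left _ _).trans (Matrix.rank_le_width _)

/-- The in-plane rows of the columns `B, AB` of `Q`. -/
theorem Q_submatrix :
    Q.submatrix (Fin.castLE (by decide : 4 ≤ 6)) ![(0, 0), (0, 1), (1, 0), (1, 1)] =
      !![0, 0, 1, 0;
         1, 0, 0, 2;
         0, 0, 0, 1;
         0, 1, -0.000294117647059, 0] := by
  ext i j
  fin_cases i <;> fin_cases j <;>
    simp [Q, A, B, Matrix.mul_apply, Fin.sum_univ_succ]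

theorem le_rank_Q : 4 ≤ Q.rank := by
  refine le_trans (le_of_eq ?_) (Q.rank_submatrix_le
    (Fin.castLE (by decide : 4 ≤ 6)) ![(0, 0), (0, 1), (1, 0), (1, 1)])
  rw [Q_submatrix, Matrix.rank_of_isUnit, Fintype.card_fin]
  rw [Matrix.isUnit_iff_isUnit_det, isUnit_iff_ne_zero]
  simp [Matrix.det_succ_row_zero, Fin.sum_univ_succ, Fin.succAbove]

theorem kalman_rank_rtheta : Q.rank = 4 ∧ Q.rank < 6 := by
  have h : Q.rank = 4 := le_antisymm rank_Q_le le_rank_Q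
  exact ⟨h, by rw [h]; decide⟩
end

section
/- Let A be the 6×6 real matrix with rows (0,1,0,0,0,0), (1.000002542612694, 0, 0, 2, 0, 0), (0,0,0,1,0,0), (0, -0.000294117647059, 0, 0, 0, 0), (0,0,0,0,0,1), (0,0,0,0,-0.00000127311747,0), and let B be the 6×2 matrix whose columns are (0,1,0,0,0,0)ᵀ and (0,0,0,1,0,0)ᵀ (thrusters in the r- and θ-directions). Then the linear control system ẋ(t) = A x(t) + B u(t) is not controllable: for every t₀ < t₁ in ℝ there exists a target state x₁ ∈ ℝ⁶ such that for every continuous control u : ℝ → ℝ² and every differentiable trajectory x : ℝ → ℝ⁶ satisfying x′(t) = A x(t) + B u(t) for all t and x(t₀) = 0, one has x(t₁) ≠ x₁. -/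
/-- The out-of-plane energy of a trajectory is unaffected by radial and tangential thrust. -/
theorem hasDerivAt_outOfPlane_energy {x : ℝ → Fin 6 → ℝ} {v : Fin 2 → ℝ} {t : ℝ}
    (h : HasDerivAt x (A.mulVec (x t) + B.mulVec v) t) :
    HasDerivAt (fun s => 0.00000127311747 * x s 4 ^ 2 + x s 5 ^ 2) 0 t := by
  have h4 : HasDerivAt (fun s => x s 4) (x t 5) t := by
    refine (hasDerivAt_pi.1 h 4).congr_deriv ?_
    simp [A, B, dotProduct, Fin.sum_univ_six]
  have h5 : HasDerivAt (fun s => x s 5) (-0.00000127311747 * x t 4) t := by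
    refine (hasDerivAt_pi.1 h 5).congr_deriv ?_
    simp [A, B, dotProduct, Fin.sum_univ_six]
  refine (((h4.pow 2).const_mul 0.00000127311747).add (h5.pow 2)).congr_deriv ?_
  ring

theorem not_controllable_rtheta :
    ∀ t₀ t₁ : ℝ, t₀ < t₁ →
      ∃ x₁ : Fin 6 → ℝ, ∀ u : ℝ → Fin 2 → ℝ, Continuous u →
        ∀ x : ℝ → Fin 6 → ℝ,
          (∀ t : ℝ, HasDerivAt x (A.mulVec (x t) + B.mulVec (u t)) t) →
          x t₀ = 0 → x t₁ ≠ x₁ := by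
  intro t₀ t₁ _
  refine ⟨Pi.single 4 1, fun u _ x hx h₀ h₁ => ?_⟩
  have hE (t : ℝ) := hasDerivAt_outOfPlane_energy (hx t)
  have h := is_const_of_deriv_eq_zero (fun t => (hE t).differentiableAt)
    (fun t => (hE t).deriv) t₁ t₀
  have h54 : (5 : Fin 6) ≠ 4 := by decide
  norm_num [h₀, h₁, Pi.single_apply, h54] at h
end
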